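/- arXiv:1810.04863 — 6 statements merged into one kernel-verified Lean document; each statement's English description precedes it below -/
import Mathlib

section
/- The Catoni influence function ψ satisfies the Catoni condition with constant C = 1/2: for every u ∈ ℝ, −log(1 − u + u²/2) ≤ ψ(u) ≤ log(1 + u + u²/2). -/
/-- The Catoni influence function. -/
noncomputable def psi (u : ℝ) : ℝ :=
  if |u| ≤ Real.sqrt 2 then u - u ^ 3 / 6
  else if u > Real.sqrt 2 then 2 * Real.sqrt 2 / 3
  else -(2 * Real.sqrt 2 / 3)

theorem one_add_add_sq_div_two_pos (u : ℝ) : 0 < 1 + u + u ^ 2 / 2 := by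
  nlinarith [sq_nonneg (u + 1)]

theorem hasDerivAt_log_sub_cubic (u : ℝ) :
    HasDerivAt (fun x : ℝ => Real.log (1 + x + x ^ 2 / 2) - (x - x ^ 3 / 6))
      (u ^ 3 * (2 + u) / (4 * (1 + u + u ^ 2 / 2))) u := by
  have hpos := one_add_add_sq_div_two_pos u
  have hquad : HasDerivAt (fun x : ℝ => 1 + x + x ^ 2 / 2) (1 + u) u :=
    (((hasDerivAt_id' u).const_add 1).add ((hasDerivAt_pow 2 u).div_const 2)).congr_deriv
      (by norm_num)
  have hcubic : HasDerivAt (fun x : ℝ => x - x ^ 3 / 6) (1 - u ^ 2 / 2) u :=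
    ((hasDerivAt_id' u).sub ((hasDerivAt_pow 3 u).div_const 6)).congr_deriv
      (by push_cast; ring)
  refine ((hquad.log hpos.ne').sub hcubic).congr_deriv ?_
  rw [div_sub' hpos.ne', div_eq_div_iff hpos.ne' (by positivity)]
  ring

/-- The cubic branch of `psi` lies below the logarithm on `[-2, ∞)`. -/
theorem cubic_le_log {u : ℝ} (hu : -2 ≤ u) :
    u - u ^ 3 / 6 ≤ Real.log (1 + u + u ^ 2 / 2) := by
  set f : ℝ → ℝ := fun x => Real.log (1 + x + x ^ 2 / 2) - (x - x ^ 3 / 6) with hf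
  have hcont : Continuous f :=
    continuous_iff_continuousAt.2 fun x => (hasDerivAt_log_sub_cubic x).continuousAt
  have hzero : f 0 = 0 := by simp [hf]
  suffices f 0 ≤ f u by
    rw [hzero] at this
    exact sub_nonneg.1 this
  rcases le_total 0 u with h | h
  · refine monotoneOn_of_hasDerivWithinAt_nonneg (convex_Ici 0) hcont.continuousOn
      (fun x _ => (hasDerivAt_log_sub_cubic x).hasDerivWithinAt) (fun x hx => ?_)
      Set.self_mem_Ici h h
    rw [interior_Ici, Set.mem_Ioi] at hx
    positivity
  · refine antitoneOn_of_hasDerivWithinAt_nonpos (convex_Icc (-2) 0) hcont.continuousOn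
      (fun x _ => (hasDerivAt_log_sub_cubic x).hasDerivWithinAt) (fun x hx => ?_)
      ⟨hu, h⟩ ⟨by norm_num, le_rfl⟩ h
    rw [interior_Icc] at hx
    have hpos := one_add_add_sq_div_two_pos x
    refine div_nonpos_of_nonpos_of_nonneg (mul_nonpos_of_nonpos_of_nonneg ?_ ?_) (by positivity)
    · exact (Odd.pow_neg (by decide) hx.2).le
    · linarith [hx.1]

theorem psi_le_log (u : ℝ) : psi u ≤ Real.log (1 + u + u ^ 2 / 2) := by
  have hsq : √2 ^ 2 = (2 : ℝ) := Real.sq_sqrt (by norm_num)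
  have hone : 1 ≤ √2 := Real.one_le_sqrt.2 (by norm_num)
  have htwo : √2 ≤ 2 := Real.sqrt_le_iff.2 (by norm_num)
  have hcube : √2 ^ 3 = 2 * √2 := by rw [pow_succ, hsq]
  unfold psi
  split_ifs with h₁ h₂
  · exact cubic_le_log (by linarith [(abs_le.1 h₁).1])
  · calc 2 * √2 / 3 = √2 - √2 ^ 3 / 6 := by rw [hcube]; ring
      _ ≤ Real.log (1 + √2 + √2 ^ 2 / 2) := cubic_le_log (by linarith)
      _ ≤ Real.log (1 + u + u ^ 2 / 2) :=
        Real.log_le_log (one_add_add_sq_div_two_pos _) (by nlinarith)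
  · have hu : u < -√2 := by
      by_contra! h
      exact h₁ (abs_le.2 ⟨h, not_lt.1 h₂⟩)
    calc -(2 * √2 / 3) = -√2 - (-√2) ^ 3 / 6 := by rw [Odd.neg_pow (by decide), hcube]; ring
      _ ≤ Real.log (1 + -√2 + (-√2) ^ 2 / 2) := cubic_le_log (by linarith)
      _ ≤ Real.log (1 + u + u ^ 2 / 2) :=
        Real.log_le_log (one_add_add_sq_div_two_pos _) (by nlinarith)

theorem psi_neg (u : ℝ) : psi (-u) = -psi u := by
  have hpos : 0 < √2 := by positivity
  unfold psi
  rw [abs_neg]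
  split_ifs with h₁ h₂ h₃ h₃
  · ring
  · linarith
  · ring
  · rfl
  · exact absurd (abs_le.2 ⟨by linarith, not_lt.1 h₃⟩) h₁

/-- The Catoni condition with constant `C = 1/2`:
`-log(1 - u + u²/2) ≤ ψ(u) ≤ log(1 + u + u²/2)` for all `u`. -/
theorem psi_catoni_condition :
    ∀ u : ℝ,
      -Real.log (1 - u + u ^ 2 / 2) ≤ psi u ∧ psi u ≤ Real.log (1 + u + u ^ 2 / 2) := by
  intro u
  refine ⟨?_, psi_le_log u⟩
  have h := psi_le_log (-u)
  rw [psi_neg, neg_sq, ← sub_eq_add_neg] at h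
  linarith
end

section
/- Let n = 2m − 1 be odd and let a₁ < a₂ < ⋯ < aₙ be strictly increasing real numbers, so that a_m is their median. Then for every scale s with 0 < s < (1/√2)·min_{i ≠ m} |a_m − a_i|, the median a_m is a Catoni-type estimate at scale s, i.e. ∑_{i=1}^{n} ψ((a_m − a_i)/s) = 0. (Proposition 1, part 1: for all sufficiently small s, the Catoni-type estimate of the margins equals their empirical median.) -/
theorem psi_zero : psi 0 = 0 := by
  simp [psi]

theorem psi_of_sqrt_two_lt {u : ℝ} (hu : √2 < u) : psi u = 2 * √2 / 3 := by
  rw [psi, if_neg (not_le.2 (hu.trans_le (le_abs_self u))), if_pos hu]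

theorem psi_of_lt_neg_sqrt_two {u : ℝ} (hu : u < -√2) : psi u = -(2 * √2 / 3) := by
  have h0 : 0 ≤ √2 := Real.sqrt_nonneg 2
  rw [psi, if_neg (not_le.2 (lt_abs.2 (Or.inr (by linarith)))), if_neg (by linarith)]

/-- A sum over `Fin n` of a function that is odd under reversal of the indices vanishes. -/
theorem Fin.sum_eq_zero_of_rev_eq_neg {n : ℕ} {f : Fin n → ℝ} (hf : ∀ i, f i.rev = -f i) :
    ∑ i, f i = 0 := by
  have h : ∑ i : Fin n, f i.rev = ∑ i, f i := Equiv.sum_comp Fin.revPerm f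
  simp only [hf, Finset.sum_neg_distrib] at h
  linarith

/-- Proposition 1, part 1: for an odd number `n = 2m+1` of strictly increasing points
`a₀ < ⋯ < a₂ₘ` (so the median is `aₘ`), for every sufficiently small scale
`0 < s < (1/√2)·min_{i ≠ m} |aₘ - aᵢ|`, the median is a Catoni-type estimate,
i.e. `∑ᵢ ψ((aₘ - aᵢ)/s) = 0`. -/
theorem median_is_catoni_estimate_for_small_scale (m : ℕ) (a : Fin (2 * m + 1) → ℝ)
    (ha : StrictMono a) (s : ℝ) (hs : 0 < s)
    (hsmall : ∀ i : Fin (2 * m + 1), i ≠ (⟨m, by omega⟩ : Fin (2 * m + 1)) →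
      s < (1 / Real.sqrt 2) * |a ⟨m, by omega⟩ - a i|) :
    ∑ i, psi ((a ⟨m, by omega⟩ - a i) / s) = 0 := by
  set c : Fin (2 * m + 1) := ⟨m, by omega⟩ with hc
  have hfar : ∀ i, i ≠ c → √2 < |a c - a i| / s := fun i hi => by
    have h := hsmall i hi
    rw [one_div_mul_eq_div, lt_div_iff₀ (by positivity)] at h
    rw [lt_div_iff₀ hs]
    linarith
  have hleft : ∀ i, i < c → psi ((a c - a i) / s) = 2 * √2 / 3 := fun i hi => by
    apply psi_of_sqrt_two_lt
    simpa [abs_of_pos (sub_pos.2 (ha hi))] using hfar i hi.ne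
  have hright : ∀ i, c < i → psi ((a c - a i) / s) = -(2 * √2 / 3) := fun i hi => by
    apply psi_of_lt_neg_sqrt_two
    have h := hfar i hi.ne'
    rw [abs_of_neg (sub_neg.2 (ha hi)), neg_div] at h
    linarith
  refine Fin.sum_eq_zero_of_rev_eq_neg fun i => ?_
  rcases lt_trichotomy i c with hi | rfl | hi
  · have hrev : c < i.rev := by
      simp only [hc, Fin.lt_def, Fin.val_rev] at hi ⊢
      omega
    rw [hleft i hi, hright _ hrev]
  · have hrev : c.rev = c := by
      simp only [hc, Fin.ext_iff, Fin.val_rev]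
      omega
    simp [hrev, psi_zero]
  · have hrev : i.rev < c := by
      simp only [hc, Fin.lt_def, Fin.val_rev] at hi ⊢
      omega
    rw [hright i hi, hleft _ hrev, neg_neg]
end

section
/- Let a₁,…,aₙ be real numbers with empirical mean ā = n⁻¹∑_{i=1}^{n} a_i. There exists a constant c > 0 (depending on a₁,…,aₙ) such that for every s > 0 and every minimizer γ̂_s of the convex function γ ↦ ∑_{i=1}^{n} ρ((γ − a_i)/s), one has |γ̂_s − ā| ≤ c/s². (Proposition 1, part 2: as s grows, the Catoni-type estimate closes in on the empirical mean at rate 1/s².) -/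
/-- The integrated Catoni loss. -/
noncomputable def rho (u : ℝ) : ℝ :=
  if |u| ≤ Real.sqrt 2 then u ^ 2 / 2 - u ^ 4 / 24
  else (2 * Real.sqrt 2 / 3) * |u| - 1 / 2

/-- The Catoni loss is strictly increasing in the absolute value of its argument. -/
theorem rho_lt_rho_of_abs_lt {u v : ℝ} (h : |u| < |v|) : rho u < rho v := by
  have h2 : Real.sqrt 2 ^ 2 = 2 := Real.sq_sqrt (by norm_num)
  have h0 : 0 < Real.sqrt 2 := by positivity
  have hu := abs_nonneg u
  have key : ∀ w : ℝ, rho w = if |w| ≤ Real.sqrt 2 then |w| ^ 2 / 2 - (|w| ^ 2) ^ 2 / 24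
      else (2 * Real.sqrt 2 / 3) * |w| - 1 / 2 := by
    intro w
    unfold rho
    rw [sq_abs, ← pow_mul]
  rw [key u, key v]
  generalize |u| = x at *
  generalize |v| = y at *
  generalize Real.sqrt 2 = r at *
  have mono : ∀ p q : ℝ, p < q → q ≤ 2 → p / 2 - p ^ 2 / 24 < q / 2 - q ^ 2 / 24 := by
    intro p q hpq hq
    nlinarith
  split_ifs with hx hy hy
  · exact mono (x ^ 2) (y ^ 2) (by nlinarith) (by nlinarith)
  · have hle : x ^ 2 / 2 - (x ^ 2) ^ 2 / 24 ≤ 5 / 6 := by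
      have : x ^ 2 ≤ 2 := by nlinarith
      nlinarith
    nlinarith
  · linarith
  · nlinarith

theorem hasDerivAt_rho {u : ℝ} (hu : |u| < Real.sqrt 2) :
    HasDerivAt rho (u - u ^ 3 / 6) u := by
  have hp : HasDerivAt (fun x : ℝ => x ^ 2 / 2 - x ^ 4 / 24) (u - u ^ 3 / 6) u := by
    refine (((hasDerivAt_pow 2 u).div_const 2).fun_sub
      ((hasDerivAt_pow 4 u).div_const 24)).congr_deriv ?_
    push_cast
    ring
  refine hp.congr_of_eventuallyEq ?_
  filter_upwards [continuous_abs.continuousAt.eventually_lt continuousAt_const hu] with x hx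
  exact if_pos hx.le

/-- A minimizer of the Catoni objective cannot leave an interval containing the data. -/
theorem abs_le_of_forall_sum_rho_le {n : ℕ} (hn : 0 < n) {a : Fin n → ℝ} {M s γhat : ℝ}
    (ha : ∀ i, |a i| ≤ M) (hs : 0 < s)
    (hmin : ∀ γ : ℝ, ∑ i, rho ((γhat - a i) / s) ≤ ∑ i, rho ((γ - a i) / s)) :
    |γhat| ≤ M := by
  have : Nonempty (Fin n) := ⟨⟨0, hn⟩⟩
  have closer : ∀ γ : ℝ, ¬ ∀ i, |γ - a i| < |γhat - a i| := by
    intro γ hγ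
    refine (hmin γ).not_gt (Finset.sum_lt_sum_of_nonempty Finset.univ_nonempty fun i _ => ?_)
    apply rho_lt_rho_of_abs_lt
    rw [abs_div, abs_div]
    exact div_lt_div_of_pos_right (hγ i) (abs_pos.2 hs.ne')
  refine abs_le.2 ⟨?_, ?_⟩
  · by_contra! h
    refine closer (-M) fun i => ?_
    have := abs_le.1 (ha i)
    rw [abs_of_nonpos (by linarith), abs_of_nonpos (by linarith)]
    linarith
  · by_contra! h
    refine closer M fun i => ?_
    have := abs_le.1 (ha i)
    rw [abs_of_nonneg (by linarith), abs_of_nonneg (by linarith)]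
    linarith

/-- The first-order condition for the Catoni objective in the polynomial regime. -/
theorem sum_sub_eq_of_forall_sum_rho_le {n : ℕ} {a : Fin n → ℝ} {s γhat : ℝ} (hs : 0 < s)
    (hu : ∀ i, |(γhat - a i) / s| < Real.sqrt 2)
    (hmin : ∀ γ : ℝ, ∑ i, rho ((γhat - a i) / s) ≤ ∑ i, rho ((γ - a i) / s)) :
    ∑ i, (γhat - a i) = ∑ i, (γhat - a i) ^ 3 / (6 * s ^ 2) := by
  have hd : HasDerivAt (fun γ : ℝ => ∑ i, rho ((γ - a i) / s))
      (∑ i, ((γhat - a i) / s - ((γhat - a i) / s) ^ 3 / 6) * (1 / s)) γhat :=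
    HasDerivAt.fun_sum fun i _ => HasDerivAt.comp (h := fun γ => (γ - a i) / s) γhat
      (hasDerivAt_rho (hu i)) (((hasDerivAt_id γhat).sub_const (a i)).div_const s)
  have hz := IsLocalMin.hasDerivAt_eq_zero (Filter.Eventually.of_forall hmin) hd
  rw [← sub_eq_zero, ← Finset.sum_sub_distrib, ← mul_zero (s ^ 2), ← hz, Finset.mul_sum]
  refine Finset.sum_congr rfl fun i _ => ?_
  field_simp

/-- Proposition 1, part 2: there is a constant `c > 0` (depending on the data) such
that for every scale `s > 0`, every minimizer `γ̂` of `γ ↦ ∑ᵢ ρ((γ - aᵢ)/s)` is within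
`c/s²` of the empirical mean. -/
theorem catoni_estimate_close_to_mean (n : ℕ) (hn : 0 < n) (a : Fin n → ℝ) :
    ∃ c > 0, ∀ s : ℝ, 0 < s → ∀ γhat : ℝ,
      (∀ γ : ℝ, ∑ i, rho ((γhat - a i) / s) ≤ ∑ i, rho ((γ - a i) / s)) →
      |γhat - (∑ i, a i) / n| ≤ c / s ^ 2 := by
  have hn' : (0 : ℝ) < n := Nat.cast_pos.2 hn
  obtain ⟨M, hM, ha⟩ : ∃ M : ℝ, 0 < M ∧ ∀ i, |a i| ≤ M := by
    refine ⟨∑ i, |a i| + 1, by positivity, fun i => ?_⟩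
    have := Finset.single_le_sum (fun j _ => abs_nonneg (a j)) (Finset.mem_univ i)
    linarith
  refine ⟨(2 * M) ^ 3, by positivity, fun s hs γhat hmin => ?_⟩
  have hγ := abs_le_of_forall_sum_rho_le hn ha hs hmin
  have hdist : ∀ i, |γhat - a i| ≤ 2 * M := fun i =>
    (abs_sub _ _).trans (by linarith [ha i])
  have hmean : γhat - (∑ i, a i) / n = (∑ i, (γhat - a i)) / n := by
    rw [Finset.sum_sub_distrib, Finset.sum_const, Finset.card_univ, Fintype.card_fin,
      nsmul_eq_mul]
    field_simp
  have hbound : ∀ (b : Fin n → ℝ) (C : ℝ), (∀ i, |b i| ≤ C) → |(∑ i, b i) / n| ≤ C := by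
    intro b C hb
    rw [abs_div, Nat.abs_cast, div_le_iff₀ hn', mul_comm]
    refine (Finset.abs_sum_le_sum_abs _ _).trans ?_
    simpa using Finset.sum_le_card_nsmul Finset.univ (fun i => |b i|) C fun i _ => hb i
  rw [hmean]
  rcases le_or_gt s (2 * M) with h | h
  · refine (hbound _ _ hdist).trans ?_
    rw [le_div_iff₀ (by positivity), pow_succ' (2 * M) 2]
    gcongr
  · have hu : ∀ i, |(γhat - a i) / s| < Real.sqrt 2 := by
      intro i
      rw [abs_div, abs_of_pos hs]
      have h1 : |γhat - a i| / s < 1 := (div_lt_one hs).2 ((hdist i).trans_lt h)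
      exact h1.trans (Real.lt_sqrt_of_sq_lt (by norm_num))
    rw [sum_sub_eq_of_forall_sum_rho_le hs hu hmin]
    refine hbound _ _ fun i => ?_
    rw [abs_div, abs_pow, abs_of_pos (by positivity : 0 < 6 * s ^ 2)]
    have := hdist i
    gcongr
    nlinarith [sq_nonneg s]
end

section
/- Stability of the Catoni-type estimate under modification of one point: let q₁,…,qₙ and q′₁,…,q′ₙ be real numbers with q_i = q′_i for all i except one index j. Let γ̂ satisfy ∑_{i=1}^{n} ψ((γ̂ − q_i)/s) = 0 and let γ̂′ satisfy ∑_{i=1}^{n} ψ((γ̂′ − q′_i)/s) = 0. Define the index set I = { i ∈ [n] : |γ̂ − q_i| ≤ s√2/2 }. If |I| ≥ 24, then |γ̂ − γ̂′| ≤ s·√(2/|I|); in particular, if |I| ≥ n/2 ≥ 24 then |γ̂ − γ̂′| ≤ 2s/√n. -/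
theorem psi_eq_clamp (u : ℝ) :
    psi u = max (-√2) (min u √2) - max (-√2) (min u √2) ^ 3 / 6 := by
  have h0 : 0 < √2 := by positivity
  have h3 : √2 ^ 3 = 2 * √2 := by rw [pow_succ, Real.sq_sqrt zero_le_two]
  unfold psi
  split_ifs with h h'
  · rw [abs_le] at h
    rw [min_eq_left h.2, max_eq_right h.1]
  · rw [min_eq_right h'.le, max_eq_right (by linarith), h3]
    ring
  · have hu : u < -√2 := by
      by_contra! hu
      exact h (abs_le.2 ⟨hu, not_lt.1 h'⟩)
    rw [min_eq_left (by linarith), max_eq_left hu.le, Odd.neg_pow (by decide), h3]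
    ring

theorem sub_cube_div_six_le {a b : ℝ} (ha : -√2 ≤ a) (hab : a ≤ b) (hb : b ≤ √2) :
    a - a ^ 3 / 6 ≤ b - b ^ 3 / 6 := by
  have h2 : √2 ^ 2 = 2 := Real.sq_sqrt zero_le_two
  have ha2 : a ^ 2 ≤ 2 := h2 ▸ sq_le_sq' ha (hab.trans hb)
  have hb2 : b ^ 2 ≤ 2 := h2 ▸ sq_le_sq' (ha.trans hab) hb
  have h : 0 ≤ (b - a) * (6 - (a ^ 2 + a * b + b ^ 2)) :=
    mul_nonneg (sub_nonneg.2 hab) (by nlinarith [sq_nonneg (a - b)])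
  linarith

theorem psi_monotone : Monotone psi := by
  intro u v huv
  have h0 : 0 < √2 := by positivity
  rw [psi_eq_clamp, psi_eq_clamp]
  exact sub_cube_div_six_le (le_max_left _ _) (max_le_max le_rfl (min_le_min huv le_rfl))
    (max_le (by linarith) (min_le_right _ _))

theorem psi_le (u : ℝ) : psi u ≤ 2 * √2 / 3 := by
  have h0 : 0 < √2 := by positivity
  have h3 : √2 ^ 3 = 2 * √2 := by rw [pow_succ, Real.sq_sqrt zero_le_two]
  rw [psi_eq_clamp]
  refine (sub_cube_div_six_le (le_max_left _ _) (max_le (by linarith) (min_le_right _ _))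
    le_rfl).trans_eq ?_
  rw [h3]
  ring

theorem neg_le_psi (u : ℝ) : -(2 * √2 / 3) ≤ psi u := by
  linarith [psi_neg u, psi_le (-u)]

/-- On the central region `|u| ≤ √2 / 2` the influence function grows with slope at least `1 / 2`. -/
theorem half_le_psi_add_sub {u r : ℝ} (hu : |u| ≤ √2 / 2) (hr : 0 ≤ r) (hr2 : r ^ 2 ≤ 1 / 12) :
    r / 2 ≤ psi (u + r) - psi u := by
  have h0 : 0 < √2 := by positivity
  have h2 : √2 ^ 2 = 2 := Real.sq_sqrt zero_le_two
  obtain ⟨hl, hu'⟩ := abs_le.1 hu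
  have hu2 : u ^ 2 ≤ 1 / 2 := by nlinarith [sq_le_sq' (by linarith) hu']
  have hr' : r ≤ √2 / 2 := by nlinarith
  unfold psi
  rw [if_pos (abs_le.2 ⟨by linarith, by linarith⟩), if_pos (abs_le.2 ⟨by linarith, by linarith⟩)]
  have h : 0 ≤ r * (1 / 2 - u ^ 2 / 2 - u * r / 2 - r ^ 2 / 6) :=
    mul_nonneg hr (by nlinarith [sq_nonneg (u - 2 * r)])
  linarith

theorem catoni_estimate_sub_le {ι : Type*} [Fintype ι] {q q' : ι → ℝ} {j : ι}
    (hqq : ∀ i, i ≠ j → q i = q' i) {s : ℝ} (hs : 0 < s) {γ γ' : ℝ}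
    (h1 : ∑ i, psi ((γ - q i) / s) = 0) (h2 : ∑ i, psi ((γ' - q' i) / s) = 0)
    {I : Finset ι} (hI : ∀ i ∈ I, |γ - q i| ≤ s * √2 / 2) (hcard : 24 ≤ I.card) :
    γ' - γ ≤ s * √(2 / I.card) := by
  classical
  set r := √(2 / (I.card : ℝ)) with hr
  have hm : (24 : ℝ) ≤ I.card := by exact_mod_cast hcard
  have hr0 : 0 < r := Real.sqrt_pos.2 (by positivity)
  have hrm : I.card * r ^ 2 = 2 := by
    rw [hr, Real.sq_sqrt (by positivity)]
    field_simp
  have hr2 : r ^ 2 ≤ 1 / 12 := by nlinarith [sq_nonneg r]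
  by_contra! hlt
  have hstep (i : ι) : (γ - q i) / s + r ≤ (γ' - q i) / s := by
    rw [div_add' _ _ _ hs.ne', div_le_div_iff_of_pos_right hs]
    linarith
  have hlower : I.card * (r / 2) ≤ ∑ i, (psi ((γ' - q i) / s) - psi ((γ - q i) / s)) := by
    rw [← nsmul_eq_mul]
    refine (I.card_nsmul_le_sum _ _ fun i hi => ?_).trans
      (Finset.sum_le_sum_of_subset_of_nonneg I.subset_univ fun i _ _ => ?_)
    · have hu : |(γ - q i) / s| ≤ √2 / 2 := by
        rw [abs_div, abs_of_pos hs, div_le_iff₀ hs]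
        linarith [hI i hi]
      linarith [half_le_psi_add_sub hu hr0.le hr2, psi_monotone (hstep i)]
    · exact sub_nonneg.2 (psi_monotone (by linarith [hstep i]))
  have hupper : ∑ i, (psi ((γ' - q i) / s) - psi ((γ' - q' i) / s)) ≤ 4 * √2 / 3 := by
    rw [Finset.sum_eq_single j (fun i _ hi => by rw [hqq i hi, sub_self]) (by simp)]
    linarith [psi_le ((γ' - q j) / s), neg_le_psi ((γ' - q' j) / s)]
  rw [Finset.sum_sub_distrib, h1, sub_zero] at hlower
  rw [Finset.sum_sub_distrib, h2, sub_zero] at hupper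
  have hone : 1 ≤ 4 * √2 / 3 * r := by nlinarith
  have hsq : (4 * √2 / 3 * r) ^ 2 < 1 := by
    have : (4 * √2 / 3 * r) ^ 2 = 16 / 9 * √2 ^ 2 * r ^ 2 := by ring
    rw [this, Real.sq_sqrt zero_le_two]
    linarith
  nlinarith

open Finset in
/-- Proposition 2 (stability): if two data sets differ in only one point `j`, and
`γ̂`, `γ̂′` are Catoni-type estimates for the respective data sets, then with
`I = {i : |γ̂ - qᵢ| ≤ s√2/2}`, if `|I| ≥ 24` then `|γ̂ - γ̂′| ≤ s√(2/|I|)`; in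
particular, if `|I| ≥ n/2 ≥ 24` then `|γ̂ - γ̂′| ≤ 2s/√n`. -/
theorem catoni_estimate_stability (n : ℕ) (q q' : Fin n → ℝ) (j : Fin n)
    (hqq : ∀ i, i ≠ j → q i = q' i) (s : ℝ) (hs : 0 < s) (γhat γhat' : ℝ)
    (h1 : ∑ i, psi ((γhat - q i) / s) = 0)
    (h2 : ∑ i, psi ((γhat' - q' i) / s) = 0)
    (I : Finset (Fin n))
    (hI : I = Finset.univ.filter fun i => |γhat - q i| ≤ s * Real.sqrt 2 / 2) :
    (24 ≤ I.card → |γhat - γhat'| ≤ s * Real.sqrt (2 / I.card)) ∧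
      ((n : ℝ) / 2 ≤ I.card → 24 ≤ (n : ℝ) / 2 →
        |γhat - γhat'| ≤ 2 * s / Real.sqrt n) := by
  have habs (hcard : 24 ≤ I.card) : |γhat - γhat'| ≤ s * Real.sqrt (2 / I.card) := by
    have hmem : ∀ i ∈ I, |γhat - q i| ≤ s * √2 / 2 := by simp [hI]
    have hle := catoni_estimate_sub_le hqq hs h1 h2 hmem hcard
    have hneg (γ : ℝ) (p : Fin n → ℝ) (h : ∑ i, psi ((γ - p i) / s) = 0) :
        ∑ i, psi ((-γ - (-p) i) / s) = 0 := by
      rw [← neg_eq_zero, ← Finset.sum_neg_distrib, ← h]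
      refine Finset.sum_congr rfl fun i _ => ?_
      rw [← psi_neg, Pi.neg_apply]
      ring_nf
    have hge := catoni_estimate_sub_le (q := -q) (q' := -q') (j := j) (fun i hi => by simp [hqq i hi]) hs
      (hneg _ _ h1) (hneg _ _ h2)
      (fun i hi => by
        have : -γhat - (-q) i = -(γhat - q i) := by rw [Pi.neg_apply]; ring
        rw [this, abs_neg]
        exact hmem i hi) hcard
    exact abs_le.2 ⟨by linarith, by linarith⟩
  refine ⟨habs, fun hn hn24 => (habs (by exact_mod_cast hn24.trans hn)).trans ?_⟩
  have hn0 : (0 : ℝ) < n := by linarith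
  have h4 : √(4 : ℝ) = 2 := by
    rw [show (4 : ℝ) = 2 ^ 2 by norm_num, Real.sqrt_sq zero_le_two]
  calc s * √(2 / I.card) ≤ s * √(4 / n) := by
        gcongr s * √?_
        rw [div_le_div_iff₀ (by linarith) hn0]
        linarith
    _ = 2 * s / √n := by
        rw [Real.sqrt_div' _ hn0.le, h4]
        ring
end

section
/- Fix γ > 0 and s = 1, and let η ∈ (0,1). Then every minimizer u* of C_η(u) = η ρ(γ − u) + (1 − η) ρ(γ + u) over u ∈ ℝ (equivalently, every solution of the first-order condition η ψ(γ − u) = (1 − η) ψ(γ + u)) lies in the open interval (−γ, γ). -/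
theorem rho_neg (u : ℝ) : rho (-u) = rho u := by
  unfold rho
  rw [abs_neg, neg_sq, Even.neg_pow (by decide : Even 4)]

theorem psi_pos {u : ℝ} (hu : 0 < u) : 0 < psi u := by
  have h2 : 0 < √2 := by positivity
  have hs : √2 ^ 2 = 2 := Real.sq_sqrt (by norm_num)
  unfold psi
  rw [abs_of_pos hu]
  split_ifs with h h'
  · have hu2 : u ^ 2 ≤ 2 := hs ▸ pow_le_pow_left₀ hu.le h 2
    nlinarith [mul_pos hu (by linarith : 0 < 6 - u ^ 2)]
  · positivity
  · exact absurd (not_le.1 h) h'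

theorem psi_nonpos {u : ℝ} (hu : u ≤ 0) : psi u ≤ 0 := by
  rcases hu.eq_or_lt with rfl | hu
  · simp [psi]
  · have h := psi_pos (neg_pos.2 hu)
    rw [psi_neg] at h
    linarith

theorem hasDerivAt_rho_of_nonneg {u : ℝ} (hu : 0 ≤ u) : HasDerivAt rho (psi u) u := by
  have h2 : 0 < √2 := by positivity
  have hs : √2 ^ 2 = 2 := Real.sq_sqrt (by norm_num)
  have hpoly (x : ℝ) : HasDerivAt (fun v : ℝ => v ^ 2 / 2 - v ^ 4 / 24) (x - x ^ 3 / 6) x := by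
    have h := ((hasDerivAt_pow 2 x).div_const 2).sub ((hasDerivAt_pow 4 x).div_const 24)
    refine h.congr_deriv ?_
    push_cast
    ring
  have hlin (x : ℝ) :
      HasDerivAt (fun v : ℝ => 2 * √2 / 3 * v - 1 / 2) (2 * √2 / 3) x := by
    simpa using ((hasDerivAt_id x).const_mul (2 * √2 / 3)).sub_const (1 / 2)
  have hrho_inner {v : ℝ} (hv : |v| ≤ √2) : rho v = v ^ 2 / 2 - v ^ 4 / 24 := if_pos hv
  have hrho_outer {v : ℝ} (hv : √2 ≤ v) : rho v = 2 * √2 / 3 * v - 1 / 2 := by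
    rcases hv.eq_or_lt with rfl | hv
    · rw [hrho_inner (abs_of_pos h2).le]
      have h4 : √2 ^ 4 = 4 := by
        rw [show √2 ^ 4 = (√2 ^ 2) ^ 2 by ring, hs]
        norm_num
      rw [h4]
      linarith
    · rw [rho, abs_of_pos (h2.trans hv), if_neg (not_le.2 hv)]
  rcases lt_trichotomy u √2 with h | rfl | h
  · have hψ : psi u = u - u ^ 3 / 6 := if_pos (by rw [abs_of_nonneg hu]; exact h.le)
    rw [hψ]
    refine (hpoly u).congr_of_eventuallyEq ?_
    filter_upwards [Ioo_mem_nhds (by linarith : -√2 < u) h] with v hv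
    exact hrho_inner (abs_le.2 ⟨hv.1.le, hv.2.le⟩)
  · have hψ : psi √2 = √2 - √2 ^ 3 / 6 := if_pos (abs_of_pos h2).le
    have hψ' : psi √2 = 2 * √2 / 3 := by
      rw [hψ, show √2 ^ 3 = √2 ^ 2 * √2 by ring, hs]
      ring
    have hleft : HasDerivWithinAt rho (psi √2) (Set.Iic √2) √2 := by
      rw [hψ]
      refine (hpoly √2).hasDerivWithinAt.congr_of_eventuallyEq ?_
        (hrho_inner (abs_of_pos h2).le)
      filter_upwards [self_mem_nhdsWithin,
        mem_nhdsWithin_of_mem_nhds (Ioi_mem_nhds (by linarith : -√2 < √2))] with v hv hv'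
      exact hrho_inner (abs_le.2 ⟨le_of_lt hv', hv⟩)
    have hright : HasDerivWithinAt rho (psi √2) (Set.Ici √2) √2 := by
      rw [hψ']
      exact (hlin √2).hasDerivWithinAt.congr (fun v hv => hrho_outer hv) (hrho_outer le_rfl)
    simpa [Set.Iic_union_Ici, hasDerivWithinAt_univ] using hleft.union hright
  · have hψ : psi u = 2 * √2 / 3 := by
      rw [psi, abs_of_nonneg hu, if_neg (not_le.2 h), if_pos h]
    rw [hψ]
    refine (hlin u).congr_of_eventuallyEq ?_
    filter_upwards [Ioi_mem_nhds h] with v hv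
    exact hrho_outer (le_of_lt hv)

theorem hasDerivAt_rho_s10 (u : ℝ) : HasDerivAt rho (psi u) u := by
  rcases le_total 0 u with hu | hu
  · exact hasDerivAt_rho_of_nonneg hu
  · have h := (hasDerivAt_rho_of_nonneg (neg_nonneg.2 hu)).scomp u (hasDerivAt_neg u)
    have hcomp : rho ∘ Neg.neg = rho := funext rho_neg
    simpa [psi_neg, hcomp] using h

theorem mem_Ioo_of_first_order {γ η u : ℝ} (hγ : 0 < γ) (hη : η ∈ Set.Ioo (0 : ℝ) 1)
    (h : η * psi (γ - u) = (1 - η) * psi (γ + u)) : u ∈ Set.Ioo (-γ) γ := by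
  have hη' : 0 < 1 - η := sub_pos.2 hη.2
  constructor <;> by_contra! hu
  · have h1 := mul_pos hη.1 (psi_pos (by linarith : 0 < γ - u))
    have h2 := mul_nonpos_of_nonneg_of_nonpos hη'.le (psi_nonpos (by linarith : γ + u ≤ 0))
    linarith
  · have h1 := mul_pos hη' (psi_pos (by linarith : 0 < γ + u))
    have h2 := mul_nonpos_of_nonneg_of_nonpos hη.1.le (psi_nonpos (by linarith : γ - u ≤ 0))
    linarith

/-- For `γ > 0`, `s = 1` and `η ∈ (0,1)`, every minimizer of
`C_η(u) = η ρ(γ - u) + (1 - η) ρ(γ + u)` (equivalently, every solution of the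
first-order condition `η ψ(γ - u) = (1 - η) ψ(γ + u)`) lies in `(-γ, γ)`. -/
theorem condRisk_minimizers_in_open_interval (γ η : ℝ) (hγ : 0 < γ)
    (hη : η ∈ Set.Ioo (0 : ℝ) 1) :
    (∀ ustar : ℝ,
      (∀ u : ℝ, η * rho (γ - ustar) + (1 - η) * rho (γ + ustar) ≤
        η * rho (γ - u) + (1 - η) * rho (γ + u)) →
      ustar ∈ Set.Ioo (-γ) γ) ∧
    (∀ ustar : ℝ, η * psi (γ - ustar) = (1 - η) * psi (γ + ustar) →
      ustar ∈ Set.Ioo (-γ) γ) := by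
  refine ⟨fun u hmin => mem_Ioo_of_first_order hγ hη ?_,
    fun u hu => mem_Ioo_of_first_order hγ hη hu⟩
  have hderiv : HasDerivAt (fun v => η * rho (γ - v) + (1 - η) * rho (γ + v))
      (η * -psi (γ - u) + (1 - η) * psi (γ + u)) u :=
    (((hasDerivAt_rho_s10 (γ - u)).comp_const_sub γ u).const_mul η).add
      (((hasDerivAt_rho_s10 (γ + u)).comp_const_add γ u).const_mul (1 - η))
  have hzero := IsLocalMin.hasDerivAt_eq_zero (Filter.Eventually.of_forall hmin) hderiv
  linarith
end

section
/- Ray-classifier lower bound (counterexample construction): let α_l < α_u be reals and let (x, y) be a random pair in ℝ × {−1, 1} whose distribution satisfies P{x ≤ α_l} = P{x ≥ α_u} = P{α_l < x < α_u} = 1/3, with y = −1 when x ∈ (α_l, α_u) and y = 1 otherwise. For α ∈ ℝ let h_α(x) = 1 if x ≤ α and h_α(x) = −1 if x > α. Then for every α ∈ ℝ, the misclassification risk satisfies P{ y ≠ h_α(x) } ≥ 1/3, and consequently the expected margin satisfies E[ y · h_α(x) ] ≤ 1/3. Hence for any prescribed margin level γ > 1/3, no classifier in this ray class can have expected margin equal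 to γ. -/
open MeasureTheory

/-- The expected margin of a `{-1, 1}`-valued prediction is one minus twice its risk. -/
theorem integral_mul_eq_one_sub_two_mul_measureReal_ne
    {Ω : Type*} [MeasurableSpace Ω] (μ : Measure Ω) [IsProbabilityMeasure μ]
    {Y H : Ω → ℝ} (hY : Measurable Y) (hH : Measurable H)
    (hY' : ∀ ω, Y ω = -1 ∨ Y ω = 1) (hH' : ∀ ω, H ω = -1 ∨ H ω = 1) :
    ∫ ω, Y ω * H ω ∂μ = 1 - 2 * μ.real {ω | Y ω ≠ H ω} := by
  have hE : MeasurableSet {ω | Y ω ≠ H ω} := (measurableSet_eq_fun hY hH).compl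
  have heq : (fun ω => Y ω * H ω) =
      fun ω => 1 - 2 * {ω | Y ω ≠ H ω}.indicator (1 : Ω → ℝ) ω := by
    funext ω
    rcases hY' ω with h | h <;> rcases hH' ω with h' | h' <;>
      norm_num [Set.indicator_apply, h, h']
  have hint : Integrable ({ω | Y ω ≠ H ω}.indicator (1 : Ω → ℝ)) μ :=
    (integrable_const (1 : ℝ)).indicator hE
  rw [heq, integral_sub (integrable_const _) (hint.const_mul 2), integral_const_mul,
    integral_indicator_one hE]
  simp

/-- Ray-classifier lower bound: under the three-segment distribution with
`P{x ≤ αₗ} = P{x ≥ αᵤ} = P{αₗ < x < αᵤ} = 1/3` and labels `y = -1` on the middle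
segment and `y = 1` elsewhere, every ray classifier `h_α(x) = I{x ≤ α} - I{x > α}`
has misclassification risk at least `1/3`, hence expected margin at most `1/3`;
consequently for any `γ > 1/3` no ray classifier has expected margin equal to `γ`. -/
theorem ray_classifier_risk_lower_bound
    {Ω : Type*} [MeasurableSpace Ω] (μ : Measure Ω) [IsProbabilityMeasure μ]
    (αl αu : ℝ) (hα : αl < αu)
    (X Y : Ω → ℝ) (hX : Measurable X) (hY : Measurable Y)
    (h1 : μ {ω | X ω ≤ αl} = ENNReal.ofReal (1 / 3))
    (h2 : μ {ω | αu ≤ X ω} = ENNReal.ofReal (1 / 3))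
    (h3 : μ {ω | αl < X ω ∧ X ω < αu} = ENNReal.ofReal (1 / 3))
    (hlabel : ∀ ω, Y ω = if αl < X ω ∧ X ω < αu then -1 else 1) :
    ∀ α : ℝ,
      ENNReal.ofReal (1 / 3) ≤ μ {ω | Y ω ≠ (if X ω ≤ α then (1 : ℝ) else -1)} ∧
      (∫ ω, Y ω * (if X ω ≤ α then (1 : ℝ) else -1) ∂μ) ≤ 1 / 3 ∧
      ∀ γ : ℝ, 1 / 3 < γ →
        (∫ ω, Y ω * (if X ω ≤ α then (1 : ℝ) else -1) ∂μ) ≠ γ := by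
  intro α
  have hrisk : ENNReal.ofReal (1 / 3) ≤
      μ {ω | Y ω ≠ (if X ω ≤ α then (1 : ℝ) else -1)} := by
    rcases lt_or_ge α αu with h | h
    · rw [← h2]
      refine measure_mono fun ω hω => ?_
      have hω' : αu ≤ X ω := hω
      have hy : Y ω = 1 := by rw [hlabel, if_neg fun hc => hc.2.not_ge hω']
      norm_num [hy, (h.trans_le hω').not_ge]
    · rw [← h3]
      refine measure_mono fun ω hω => ?_
      have hy : Y ω = -1 := (hlabel ω).trans (if_pos hω)
      norm_num [hy, hω.2.le.trans h]
  have hmargin : (∫ ω, Y ω * (if X ω ≤ α then (1 : ℝ) else -1) ∂μ) ≤ 1 / 3 := by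
    rw [integral_mul_eq_one_sub_two_mul_measureReal_ne μ hY
      (Measurable.ite (measurableSet_le hX measurable_const) measurable_const measurable_const)
      (fun ω => by rw [hlabel]; split_ifs <;> simp) (fun ω => by split_ifs <;> simp)]
    have hr := (ENNReal.ofReal_le_iff_le_toReal (measure_ne_top μ _)).1 hrisk
    rw [← measureReal_def] at hr
    linarith
  exact ⟨hrisk, hmargin, fun γ hγ => (hmargin.trans_lt hγ).ne⟩
end
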